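/- Let ν ∈ ℝ³ be a unit vector, let η, τ ∈ ℝ with d = η² − τ² ≠ −4, let M = (i/2)(α·ν)(η I₄ + τ β), and let R_{η,τ} = (I₄ − M)⁻¹(I₄ + M). Then R_{η,τ} has the explicit form R_{η,τ} = (4/(4+d))[ ((4−d)/4) I₄ + i(α·ν)(η I₄ + τ β) ]. -/

import Mathlib

open Matrix

/-- The Pauli matrices σ₁, σ₂, σ₃. -/
noncomputable def pauli : Fin 3 → Matrix (Fin 2) (Fin 2) ℂ :=
  ![!![0, 1; 1, 0], !![0, -Complex.I; Complex.I, 0], !![1, 0; 0, -1]]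

/-- The Dirac matrices α₁, α₂, α₃, in 2×2 block form αₖ = [[0, σₖ], [σₖ, 0]]. -/
noncomputable def diracAlpha (k : Fin 3) : Matrix (Fin 4) (Fin 4) ℂ :=
  Matrix.reindex finSumFinEquiv finSumFinEquiv
    (Matrix.fromBlocks 0 (pauli k) (pauli k) 0)

/-- The Dirac matrix β = [[I₂, 0], [0, -I₂]]. -/
noncomputable def diracBeta : Matrix (Fin 4) (Fin 4) ℂ :=
  Matrix.reindex finSumFinEquiv finSumFinEquiv
    (Matrix.fromBlocks (1 : Matrix (Fin 2) (Fin 2) ℂ) (0 : Matrix (Fin 2) (Fin 2) ℂ) (0 : Matrix (Fin 2) (Fin 2) ℂ) (-1 : Matrix (Fin 2) (Fin 2) ℂ))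

/-- For ν ∈ ℝ³, the matrix α·ν = ν₁α₁ + ν₂α₂ + ν₃α₃. -/
noncomputable def alphaDot (ν : Fin 3 → ℝ) : Matrix (Fin 4) (Fin 4) ℂ :=
  (ν 0 : ℂ) • diracAlpha 0 + (ν 1 : ℂ) • diracAlpha 1 + (ν 2 : ℂ) • diracAlpha 2

theorem diracBeta_mul_self : diracBeta * diracBeta = 1 := by
  simp [diracBeta, Matrix.submatrix_mul_equiv, Matrix.fromBlocks_multiply, Matrix.fromBlocks_one]

theorem alphaDot_eq_reindex (ν : Fin 3 → ℝ) :
    alphaDot ν = Matrix.reindex finSumFinEquiv finSumFinEquiv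
      (Matrix.fromBlocks 0 (∑ k, (ν k : ℂ) • pauli k) (∑ k, (ν k : ℂ) • pauli k) 0) := by
  ext i j
  simp only [alphaDot, diracAlpha, Fin.sum_univ_three, Matrix.reindex_apply,
    Matrix.add_apply, Matrix.smul_apply, Matrix.submatrix_apply]
  rcases (finSumFinEquiv (m := 2) (n := 2)).symm i with i | i <;>
    rcases (finSumFinEquiv (m := 2) (n := 2)).symm j with j | j <;> simp

theorem pauliDot_mul_self (ν : Fin 3 → ℝ) :
    (∑ k, (ν k : ℂ) • pauli k) * (∑ k, (ν k : ℂ) • pauli k) =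
      ((ν 0 ^ 2 + ν 1 ^ 2 + ν 2 ^ 2 : ℝ) : ℂ) • (1 : Matrix (Fin 2) (Fin 2) ℂ) := by
  ext i j
  fin_cases i <;> fin_cases j <;>
    simp [pauli, Fin.sum_univ_three, Matrix.mul_apply, Fin.sum_univ_two] <;>
    ring_nf <;> simp [Complex.I_sq]

theorem alphaDot_mul_self (ν : Fin 3 → ℝ) :
    alphaDot ν * alphaDot ν = ((ν 0 ^ 2 + ν 1 ^ 2 + ν 2 ^ 2 : ℝ) : ℂ) • 1 := by
  rw [alphaDot_eq_reindex, Matrix.reindex_apply, Matrix.submatrix_mul_equiv,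
    Matrix.fromBlocks_multiply, pauliDot_mul_self]
  simp only [zero_mul, mul_zero, zero_add, add_zero]
  have hone : (1 : Matrix (Fin 4) (Fin 4) ℂ) = (Matrix.fromBlocks 1 0 0 1).submatrix
      (finSumFinEquiv (m := 2) (n := 2)).symm (finSumFinEquiv (m := 2) (n := 2)).symm := by
    rw [Matrix.fromBlocks_one, Matrix.submatrix_one_equiv]
  rw [hone]
  ext i j
  simp only [Matrix.smul_apply, Matrix.submatrix_apply]
  rcases (finSumFinEquiv (m := 2) (n := 2)).symm i with i | i <;>
    rcases (finSumFinEquiv (m := 2) (n := 2)).symm j with j | j <;> simp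

theorem diracBeta_mul_alphaDot (ν : Fin 3 → ℝ) :
    diracBeta * alphaDot ν = -(alphaDot ν * diracBeta) := by
  rw [alphaDot_eq_reindex, diracBeta, Matrix.reindex_apply, Matrix.reindex_apply,
    Matrix.submatrix_mul_equiv, Matrix.submatrix_mul_equiv, Matrix.fromBlocks_multiply,
    Matrix.fromBlocks_multiply]
  ext i j
  simp only [Matrix.neg_apply, Matrix.submatrix_apply]
  rcases (finSumFinEquiv (m := 2) (n := 2)).symm i with i | i <;>
    rcases (finSumFinEquiv (m := 2) (n := 2)).symm j with j | j <;> simp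

theorem alphaDot_mul_add_sq (ν : Fin 3 → ℝ) (hν : ν 0 ^ 2 + ν 1 ^ 2 + ν 2 ^ 2 = 1) (a b : ℂ) :
    (alphaDot ν * (a • 1 + b • diracBeta)) * (alphaDot ν * (a • 1 + b • diracBeta)) =
      (a ^ 2 - b ^ 2) • 1 := by
  have hcomm : (a • 1 + b • diracBeta) * alphaDot ν = alphaDot ν * (a • 1 - b • diracBeta) := by
    simp only [add_mul, mul_sub, smul_mul_assoc, mul_smul_comm, one_mul, mul_one,
      diracBeta_mul_alphaDot, smul_neg, ← sub_eq_add_neg]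
  have hprod : (a • 1 - b • diracBeta) * (a • 1 + b • diracBeta) = (a ^ 2 - b ^ 2) • 1 := by
    simp only [sub_mul, mul_add, smul_mul_smul_comm, one_mul, mul_one, diracBeta_mul_self]
    module
  calc _ = alphaDot ν * ((a • 1 + b • diracBeta) * alphaDot ν) * (a • 1 + b • diracBeta) := by
        simp only [mul_assoc]
    _ = (alphaDot ν * alphaDot ν) * ((a • 1 - b • diracBeta) * (a • 1 + b • diracBeta)) := by
        rw [hcomm]; simp only [mul_assoc]
    _ = _ := by rw [alphaDot_mul_self, hν, hprod]; simp

/-- The Cayley transform of a matrix whose square is scalar. -/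
theorem inv_one_sub_mul_one_add_of_mul_self {n : Type*} [Fintype n] [DecidableEq n]
    {A : Matrix n n ℂ} {d : ℂ} (hA : A * A = d • 1) (hd : 4 + d ≠ 0) :
    (1 - (Complex.I / 2) • A)⁻¹ * (1 + (Complex.I / 2) • A) =
      (4 / (4 + d)) • (((4 - d) / 4) • 1 + Complex.I • A) := by
  have hI : Complex.I / 2 * (Complex.I / 2) = -1 / 4 := by
    linear_combination Complex.I_sq / 4
  have hinv : (1 - (Complex.I / 2) • A) * ((4 / (4 + d)) • (1 + (Complex.I / 2) • A)) = 1 := by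
    have h : (1 - (Complex.I / 2) • A) * (1 + (Complex.I / 2) • A) = ((4 + d) / 4) • 1 := by
      simp only [sub_mul, mul_add, smul_mul_smul_comm, one_mul, mul_one, hA, hI]
      module
    rw [mul_smul_comm, h, smul_smul, div_mul_div_cancel₀ hd, div_self (by norm_num), one_smul]
  rw [Matrix.inv_eq_right_inv hinv, smul_mul_assoc]
  congr 1
  simp only [add_mul, mul_add, smul_mul_smul_comm, one_mul, mul_one, hA, hI]
  module

/-- Explicit form of R_{η,τ} = (I₄ − M)⁻¹(I₄ + M):
R_{η,τ} = (4/(4+d))[((4−d)/4) I₄ + i(α·ν)(η I₄ + τβ)]. -/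
theorem R_explicit_form (ν : Fin 3 → ℝ) (hν : ν 0 ^ 2 + ν 1 ^ 2 + ν 2 ^ 2 = 1)
    (η τ d : ℝ) (hd : d = η ^ 2 - τ ^ 2) (hd4 : d ≠ -4)
    (M : Matrix (Fin 4) (Fin 4) ℂ)
    (hM : M = (Complex.I / 2) • (alphaDot ν * ((η : ℂ) • 1 + (τ : ℂ) • diracBeta)))
    (R : Matrix (Fin 4) (Fin 4) ℂ) (hR : R = (1 - M)⁻¹ * (1 + M)) :
    R = ((4 : ℂ) / ((4 : ℂ) + (d : ℂ))) •
      (((((4 : ℂ) - (d : ℂ)) / 4) • 1)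
        + Complex.I • (alphaDot ν * ((η : ℂ) • 1 + (τ : ℂ) • diracBeta))) := by
  have hd' : (4 : ℂ) + d ≠ 0 := by
    norm_cast
    intro h
    exact hd4 (by linarith)
  rw [hR, hM]
  refine inv_one_sub_mul_one_add_of_mul_self ?_ hd'
  rw [alphaDot_mul_add_sq ν hν, hd]
  push_cast
  rfl
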